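/- (Williams–Hardy) Let q be a prime power and r an odd prime with q ≡ 1 (mod r). Let c ≠ 0 be an r-th power residue in F_q, b ∈ F_q with b^r - c not an r-th power residue, θ ∈ F_{q^r} with θ^r = b^r - c, and α = b - θ. Set E_1 = α^((q-1)^(r-2)) and E_2 = α^M where M = ((q^r - 1)/(q - 1) - (q - 1)^(r-1))/r is an integer. Then x = E_1^((q-1)/r) · E_2 lies in (the image of) F_q and satisfies x^r = c. -/

import Mathlib

open Polynomial in
/-- In an extension `K` of a finite field `F`, the fixed points of `x ↦ x ^ #F` lie in `F`. -/
theorem FiniteField.mem_range_algebraMap_of_pow_card_eq_self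
    {F K : Type*} [Field F] [Field K] [Fintype F] [Algebra F K]
    {x : K} (hx : x ^ Fintype.card F = x) : x ∈ Set.range (algebraMap F K) := by
  have hcard : 1 < Fintype.card F := Fintype.one_lt_card
  have hmonic : (X ^ Fintype.card F - X : F[X]).Monic :=
    monic_X_pow_sub (by rw [degree_X]; exact_mod_cast hcard)
  have hprod := prod_multiset_X_sub_C_of_monic_of_roots_card_eq hmonic (by
    rw [FiniteField.roots_X_pow_card_sub_X, FiniteField.X_pow_card_sub_X_natDegree_eq F hcard]
    rfl)
  rw [FiniteField.roots_X_pow_card_sub_X] at hprod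
  have h := congrArg (aeval x) hprod
  change aeval x (∏ a : F, (X - C a)) = _ at h
  simp only [map_prod, map_sub, map_pow, aeval_X, aeval_C, hx, sub_self,
    Finset.prod_eq_zero_iff, Finset.mem_univ, true_and] at h
  obtain ⟨a, ha⟩ := h
  exact ⟨a, (sub_eq_zero.mp ha).symm⟩

/-- A primitive `n`-th root of unity `ζ` factors `x ^ n - y ^ n` over the powers of `ζ`. -/
theorem IsPrimitiveRoot.prod_range_sub_pow_mul {R : Type*} [CommRing R] [IsDomain R]
    {n : ℕ} {ζ : R} (hn : 0 < n) (h : IsPrimitiveRoot ζ n) (x y : R) :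
    ∏ i ∈ Finset.range n, (x - ζ ^ i * y) = x ^ n - y ^ n := by
  have : NeZero n := ⟨hn.ne'⟩
  rw [h.pow_sub_pow_eq_prod_sub_mul x y hn]
  refine Finset.prod_bij (fun i _ => ζ ^ i) (fun i _ => ?_) (fun i hi j hj hij => ?_)
    (fun ξ hξ => ?_) (fun _ _ => rfl)
  · rw [Polynomial.mem_nthRootsFinset hn, ← pow_mul, mul_comm, pow_mul, h.pow_eq_one, one_pow]
  · exact h.pow_inj (Finset.mem_range.mp hi) (Finset.mem_range.mp hj) hij
  · obtain ⟨i, hi, rfl⟩ := h.eq_pow_of_pow_eq_one ((Polynomial.mem_nthRootsFinset hn 1).mp hξ)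
    exact ⟨i, Finset.mem_range.mpr hi, rfl⟩

/-- If `a` is not an `r`-th power in `F`, where `r` is a prime dividing `#F - 1`, and `θ ^ r = a`,
then the norm-type power of `b - θ` with exponent `1 + q + ⋯ + q ^ (r - 1)` is `b ^ r - a`. -/
theorem FiniteField.sub_pow_geom_sum_eq
    {F K : Type*} [Field F] [Field K] [Fintype F] [Algebra F K]
    {r : ℕ} (hr : r.Prime) (hdvd : r ∣ Fintype.card F - 1) {a : F}
    (ha : ¬ ∃ x : F, x ^ r = a) (b : F) {θ : K} (hθ : θ ^ r = algebraMap F K a) :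
    (algebraMap F K b - θ) ^ (∑ i ∈ Finset.range r, Fintype.card F ^ i) =
      algebraMap F K (b ^ r - a) := by
  set q := Fintype.card F with hq
  have hq1 : 1 ≤ q := Fintype.card_pos
  have ha0 : a ≠ 0 := fun h => ha ⟨0, by rw [h, zero_pow hr.ne_zero]⟩
  have hθ0 : θ ≠ 0 := by
    rintro rfl
    rw [zero_pow hr.ne_zero, eq_comm, map_eq_zero] at hθ
    exact ha0 hθ
  obtain ⟨ζ, hζ⟩ : ∃ ζ : K, ζ = θ ^ (q - 1) := ⟨_, rfl⟩
  have hθq : θ ^ q = ζ * θ := by rw [hζ, ← pow_succ, Nat.sub_add_cancel hq1]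
  have hζr : ζ ^ r = 1 := by
    rw [hζ, ← pow_mul, mul_comm, pow_mul, hθ, ← map_pow,
      FiniteField.pow_card_sub_one_eq_one a ha0, map_one]
  have hζ1 : ζ ≠ 1 := by
    rintro rfl
    obtain ⟨t, rfl⟩ :=
      FiniteField.mem_range_algebraMap_of_pow_card_eq_self (hθq.trans (one_mul θ))
    rw [← map_pow] at hθ
    exact ha ⟨t, (algebraMap F K).injective hθ⟩
  have hprim : IsPrimitiveRoot ζ r := by
    have : Fact r.Prime := ⟨hr⟩
    exact (orderOf_eq_prime hζr hζ1) ▸ IsPrimitiveRoot.orderOf ζ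
  have hζq : ζ ^ q = ζ := by
    obtain ⟨k, hk⟩ := hdvd
    rw [← Nat.sub_add_cancel hq1, hk, pow_succ, pow_mul, hζr, one_pow, one_mul]
  have hconj : ∀ i, (algebraMap F K b - θ) ^ q ^ i = algebraMap F K b - ζ ^ i * θ := by
    intro i
    induction i with
    | zero => simp
    | succ i ih =>
      have hfrob := map_sub (FiniteField.frobeniusAlgHom F K) (algebraMap F K b) (ζ ^ i * θ)
      simp only [FiniteField.coe_frobeniusAlgHom, ← hq] at hfrob
      rw [pow_succ, pow_mul, ih, hfrob, mul_pow, hθq, ← pow_mul, mul_comm i q, pow_mul, hζq,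
        ← map_pow, FiniteField.pow_card, pow_succ, mul_assoc]
  rw [← Finset.prod_pow_eq_pow_sum, Finset.prod_congr rfl fun i _ => hconj i,
    hprim.prod_range_sub_pow_mul hr.pos, hθ, map_sub, map_pow]


/-- Williams–Hardy: with `E₁ = α^((q-1)^(r-2))` and `E₂ = α^M` where
`M = ((q^r-1)/(q-1) - (q-1)^(r-1))/r`, the element `x = E₁^((q-1)/r) · E₂` lies in `F_q`
and satisfies `x^r = c`. -/
theorem williams_hardy_rth_root
    (F K : Type*) [Field F] [Field K] [Fintype F] [Fintype K] [Algebra F K]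
    (q r : ℕ) (hq : q = Fintype.card F) (hK : Fintype.card K = q ^ r)
    (hrp : r.Prime) (hrodd : Odd r) (hqr : q ≡ 1 [MOD r])
    (c : F) (hc0 : c ≠ 0) (hc : ∃ x : F, x ^ r = c)
    (b : F) (hb : ¬ ∃ x : F, x ^ r = b ^ r - c)
    (θ : K) (hθ : θ ^ r = algebraMap F K (b ^ r - c))
    (M : ℕ)
    (hM : (M : ℤ) * r = (∑ i ∈ Finset.range r, (q : ℤ) ^ i) - ((q : ℤ) - 1) ^ (r - 1)) :
    ((algebraMap F K b - θ) ^ ((q - 1) ^ (r - 2))) ^ ((q - 1) / r) *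
        (algebraMap F K b - θ) ^ M ∈ Set.range (algebraMap F K) ∧
    (((algebraMap F K b - θ) ^ ((q - 1) ^ (r - 2))) ^ ((q - 1) / r) *
        (algebraMap F K b - θ) ^ M) ^ r = algebraMap F K c := by
  subst hq
  obtain ⟨y, rfl⟩ := hc
  have hq1 : 1 ≤ Fintype.card F := Fintype.card_pos
  have hdvd : r ∣ Fintype.card F - 1 := (Nat.modEq_iff_dvd' hq1).mp hqr.symm
  have hr2 : r - 2 + 1 = r - 1 := by have := hrp.two_le; omega
  have hexp : ((Fintype.card F - 1) ^ (r - 2) * ((Fintype.card F - 1) / r) + M) * r =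
      ∑ i ∈ Finset.range r, Fintype.card F ^ i := by
    rw [add_mul, mul_assoc, Nat.div_mul_cancel hdvd, ← pow_succ, hr2]
    zify [hq1]
    rw [hM]
    ring
  have hroot : (((algebraMap F K b - θ) ^ ((Fintype.card F - 1) ^ (r - 2))) ^
      ((Fintype.card F - 1) / r) * (algebraMap F K b - θ) ^ M) ^ r = algebraMap F K (y ^ r) := by
    rw [← pow_mul, ← pow_add, ← pow_mul, hexp, FiniteField.sub_pow_geom_sum_eq hrp hdvd hb b hθ,
      sub_sub_cancel]
  refine ⟨FiniteField.mem_range_algebraMap_of_pow_card_eq_self ?_, hroot⟩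
  have hy0 : y ≠ 0 := fun h => hc0 (by rw [h, zero_pow hrp.ne_zero])
  generalize ((algebraMap F K b - θ) ^ ((Fintype.card F - 1) ^ (r - 2))) ^
      ((Fintype.card F - 1) / r) * (algebraMap F K b - θ) ^ M = x at hroot ⊢
  have hx : x ^ (Fintype.card F - 1) = 1 := by
    rw [← Nat.mul_div_cancel' hdvd, pow_mul, hroot, ← map_pow, ← pow_mul,
      Nat.mul_div_cancel' hdvd, FiniteField.pow_card_sub_one_eq_one y hy0, map_one]
  rw [← Nat.sub_add_cancel hq1, pow_succ, hx, one_mul]
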